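/- For an end ω of G with end tangle τ and k ∈ ℕ, the following are equivalent: (i) τ ∩ S⃗_k is closed in S⃗_k; (ii) deg(ω) + dom(ω) ≥ k; (iii) τ ∩ S⃗_k has a finite relative decider; (iv) τ ∩ S⃗_k has a relative decider of size exactly k. -/

import Mathlib

open Set

universe u

/-- A separation of a graph `G`: a pair of vertex sets covering `V` with no
edge between `A \ B` and `B \ A`. -/
structure Separation {V : Type u} (G : SimpleGraph V) where
  A : Set V
  B : Set V
  union_eq : A ∪ B = Set.univ
  no_edge : ∀ a ∈ A \ B, ∀ b ∈ B \ A, ¬ G.Adj a b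

/-- The oriented separations of finite order. -/
abbrev FinSep {V : Type u} (G : SimpleGraph V) := {s : Separation G // (s.A ∩ s.B).Finite}

/-- The separation topology: basic open sets prescribe the restriction of a
separation to a finite vertex set `Z`. -/
instance sepTop {V : Type u} (G : SimpleGraph V) : TopologicalSpace (FinSep G) :=
  TopologicalSpace.generateFrom
    {O | ∃ Z AZ BZ : Set V, Z.Finite ∧
      O = {s : FinSep G | s.1.A ∩ Z = AZ ∧ s.1.B ∩ Z = BZ}}

/-- The reverse orientation of a finite-order separation. -/
def FinSep.rev {V : Type u} {G : SimpleGraph V} (s : FinSep G) : FinSep G :=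
  ⟨⟨s.1.B, s.1.A, by rw [Set.union_comm]; exact s.1.union_eq,
    fun a ha b hb h => s.1.no_edge b hb a ha h.symm⟩,
   by rw [Set.inter_comm]; exact s.2⟩

/-- A ray in a graph: an injective sequence of successively adjacent vertices. -/
structure GraphRay {V : Type u} (G : SimpleGraph V) where
  f : ℕ → V
  inj : Function.Injective f
  adj : ∀ n, G.Adj (f n) (f (n + 1))

/-- Two rays are equivalent if no finite vertex set separates them. -/
def RayEquiv {V : Type u} (G : SimpleGraph V) (R R' : GraphRay G) : Prop :=
  ∀ F : Set V, F.Finite →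
    ∃ (m n : ℕ) (w : G.Walk (R.f m) (R'.f n)), ∀ x ∈ w.support, x ∉ F

/-- An end of a graph: a (nonempty) equivalence class of rays. -/
structure GraphEnd {V : Type u} (G : SimpleGraph V) where
  rays : Set (GraphRay G)
  nonempty : rays.Nonempty
  mem_iff : ∀ R ∈ rays, ∀ R', R' ∈ rays ↔ RayEquiv G R R'

/-- A ray has a tail in `B`. -/
def HasTailIn {V : Type u} {G : SimpleGraph V} (R : GraphRay G) (B : Set V) : Prop :=
  ∃ N, ∀ n ≥ N, R.f n ∈ B

/-- The end tangle induced by the end `ω`: all finite-order separations `(A,B)`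
such that every ray of `ω` has a tail in `B`. -/
def endTangle {V : Type u} {G : SimpleGraph V} (ω : GraphEnd G) : Set (FinSep G) :=
  {s | ∀ R ∈ ω.rays, HasTailIn R s.1.B}

/-- `v` dominates the end `ω`: `v` sends infinitely many paths to a ray of `ω`
which pairwise meet only in `v`. -/
def Dominates {V : Type u} (G : SimpleGraph V) (v : V) (ω : GraphEnd G) : Prop :=
  ∃ R ∈ ω.rays, ∃ p : ℕ → (n : ℕ) × G.Walk v (R.f n),
    (∀ i, (p i).2.IsPath) ∧ (Function.Injective fun i => (p i).1) ∧
    ∀ i j, i ≠ j → ∀ x, x ∈ (p i).2.support → x ∈ (p j).2.support → x = v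

/-- The end `ω` has (vertex) degree at least `m`: there are `m` pairwise
disjoint rays belonging to `ω`. -/
def DegGE {V : Type u} (G : SimpleGraph V) (ω : GraphEnd G) (m : ℕ) : Prop :=
  ∃ R : Fin m → GraphRay G, (∀ i, R i ∈ ω.rays) ∧
    ∀ i j, i ≠ j → Disjoint (Set.range (R i).f) (Set.range (R j).f)

/-- At least `n` vertices dominate `ω`. -/
def DomGE {V : Type u} (G : SimpleGraph V) (ω : GraphEnd G) (n : ℕ) : Prop :=
  ∃ D : Finset V, D.card = n ∧ ∀ v ∈ D, Dominates G v ω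

/-- `deg(ω) + dom(ω) ≥ k`. -/
def DegDomGE {V : Type u} (G : SimpleGraph V) (ω : GraphEnd G) (k : ℕ) : Prop :=
  ∃ m n, m + n = k ∧ DegGE G ω m ∧ DomGE G ω n

/-- `T` separates `X` from the end `ω`: every ray of `ω` meeting `X` meets `T`. -/
def SeparatesFromEnd {V : Type u} (G : SimpleGraph V) (X T : Set V) (ω : GraphEnd G) : Prop :=
  ∀ R ∈ ω.rays, (∃ n, R.f n ∈ X) → ∃ n, R.f n ∈ T

/-- `K` is `(<ℵ₀)`-inseparable (apart from the infiniteness requirement): no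
finite-order separation separates two of its vertices. -/
def FinInseparable {V : Type u} (G : SimpleGraph V) (K : Set V) : Prop :=
  ∀ s : FinSep G, ∀ x ∈ K, ∀ y ∈ K, ¬(x ∈ s.1.A \ s.1.B ∧ y ∈ s.1.B \ s.1.A)

/-- An `ℵ₀`-block: a maximal infinite set of vertices no two of which can be
separated by a finite-order separation. -/
def Aleph0Block {V : Type u} (G : SimpleGraph V) (K : Set V) : Prop :=
  K.Infinite ∧ FinInseparable G K ∧
    ∀ K' : Set V, K ⊆ K' → K'.Infinite → FinInseparable G K' → K' = K

/-- `u` and `v` are joined by a walk inside the vertex set `S`. -/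
def WalkIn {V : Type u} (G : SimpleGraph V) (S : Set V) (u v : V) : Prop :=
  ∃ w : G.Walk u v, ∀ x ∈ w.support, x ∈ S

namespace WalkIn

variable {V : Type u} {G : SimpleGraph V} {S T : Set V} {u v w : V}

theorem refl (h : u ∈ S) : WalkIn G S u u := ⟨.nil, by simpa using h⟩

theorem symm (h : WalkIn G S u v) : WalkIn G S v u := by
  obtain ⟨p, hp⟩ := h
  exact ⟨p.reverse, by simpa using hp⟩

theorem trans (h : WalkIn G S u v) (h' : WalkIn G S v w) : WalkIn G S u w := by
  obtain ⟨p, hp⟩ := h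
  obtain ⟨q, hq⟩ := h'
  refine ⟨p.append q, fun x hx => ?_⟩
  rcases SimpleGraph.Walk.mem_support_append_iff _ _ |>.1 hx with h | h
  exacts [hp x h, hq x h]

theorem mono (hST : S ⊆ T) (h : WalkIn G S u v) : WalkIn G T u v := by
  obtain ⟨p, hp⟩ := h
  exact ⟨p, fun x hx => hST (hp x hx)⟩

theorem of_adj (h : G.Adj u v) (hu : u ∈ S) (hv : v ∈ S) : WalkIn G S u v :=
  ⟨.cons h .nil, by simp [hu, hv]⟩

theorem left_mem (h : WalkIn G S u v) : u ∈ S := by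
  obtain ⟨p, hp⟩ := h
  exact hp _ p.start_mem_support

theorem right_mem (h : WalkIn G S u v) : v ∈ S := h.symm.left_mem

theorem induct {P : V → Prop} (h : WalkIn G S u v)
    (step : ∀ a b, a ∈ S → b ∈ S → G.Adj a b → P a → P b) (hu : P u) : P v := by
  obtain ⟨p, hp⟩ := h
  induction p with
  | nil => exact hu
  | cons hadj q ih =>
    simp only [SimpleGraph.Walk.support_cons, List.mem_cons, forall_eq_or_imp] at hp
    exact ih (step _ _ hp.1 (hp.2 _ q.start_mem_support) hadj hu) hp.2

end WalkIn

section EndComponent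

variable {V : Type u} {G : SimpleGraph V} {ω : GraphEnd G}

theorem GraphRay.eventually_not_mem (R : GraphRay G) {F : Set V} (hF : F.Finite) :
    ∃ N, ∀ n ≥ N, R.f n ∉ F := by
  obtain ⟨N, hN⟩ := (hF.preimage R.inj.injOn).bddAbove
  exact ⟨N + 1, fun n hn h => by have := hN (show n ∈ R.f ⁻¹' F from h); omega⟩

theorem GraphRay.walkIn (R : GraphRay G) {S : Set V} {m n : ℕ} (hmn : m ≤ n)
    (h : ∀ i, m ≤ i → i ≤ n → R.f i ∈ S) : WalkIn G S (R.f m) (R.f n) := by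
  induction n, hmn using Nat.le_induction with
  | base => exact .refl (h m le_rfl le_rfl)
  | succ n hmn ih =>
    exact (ih fun i h1 h2 => h i h1 (by omega)).trans
      (.of_adj (R.adj n) (h _ hmn (by omega)) (h _ (by omega) le_rfl))

/-- The component of `G - F` in which the end `ω` lives. -/
def endComp (ω : GraphEnd G) (F : Set V) : Set V :=
  {v | ∃ R ∈ ω.rays, ∃ n, (∀ m ≥ n, R.f m ∉ F) ∧ WalkIn G Fᶜ v (R.f n)}

theorem not_mem_of_mem_endComp {F : Set V} {v : V} (h : v ∈ endComp ω F) : v ∉ F := by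
  obtain ⟨R, -, n, -, h⟩ := h
  exact h.left_mem

theorem mem_endComp_of_walkIn {F : Set V} {u v : V} (h : WalkIn G Fᶜ u v)
    (hv : v ∈ endComp ω F) : u ∈ endComp ω F := by
  obtain ⟨R, hR, n, hn, h'⟩ := hv
  exact ⟨R, hR, n, hn, h.trans h'⟩

theorem mem_endComp_of_adj {F : Set V} {u v : V} (h : G.Adj u v) (hu : u ∉ F)
    (hv : v ∈ endComp ω F) : u ∈ endComp ω F :=
  mem_endComp_of_walkIn (.of_adj h hu (not_mem_of_mem_endComp hv)) hv

theorem endComp_anti {F F' : Set V} (h : F ⊆ F') : endComp ω F' ⊆ endComp ω F := by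
  rintro v ⟨R, hR, n, hn, hv⟩
  exact ⟨R, hR, n, fun m hm hF => hn m hm (h hF), hv.mono (compl_subset_compl.2 h)⟩

theorem eventually_mem_endComp {F : Set V} (hF : F.Finite) {R : GraphRay G} (hR : R ∈ ω.rays) :
    ∃ N, ∀ n ≥ N, R.f n ∈ endComp ω F := by
  obtain ⟨N, hN⟩ := R.eventually_not_mem hF
  exact ⟨N, fun n hn => ⟨R, hR, n, fun m hm => hN m (by omega), .refl (hN n hn)⟩⟩

theorem walkIn_of_mem_endComp {F : Set V} (hF : F.Finite) {u v : V}
    (hu : u ∈ endComp ω F) (hv : v ∈ endComp ω F) : WalkIn G Fᶜ u v := by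
  obtain ⟨R, hR, n, hn, hu⟩ := hu
  obtain ⟨R', hR', n', hn', hv⟩ := hv
  obtain ⟨m, m', w, hw⟩ := (ω.mem_iff R hR R').1 hR' (F ∪ R.f '' Iio n ∪ R'.f '' Iio n')
    ((hF.union ((finite_Iio n).image _)).union ((finite_Iio n').image _))
  have hm : n ≤ m := by
    by_contra h
    exact hw _ w.start_mem_support (Or.inl (Or.inr ⟨m, by simpa using h, rfl⟩))
  have hm' : n' ≤ m' := by
    by_contra h
    exact hw _ w.end_mem_support (Or.inr ⟨m', by simpa using h, rfl⟩)
  have h1 : WalkIn G Fᶜ (R.f n) (R.f m) := R.walkIn hm fun i hi _ => hn i hi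
  have h2 : WalkIn G Fᶜ (R'.f n') (R'.f m') := R'.walkIn hm' fun i hi _ => hn' i hi
  have h3 : WalkIn G Fᶜ (R.f m) (R'.f m') :=
    ⟨w, fun x hx hxF => hw x hx (Or.inl (Or.inl hxF))⟩
  exact hu.trans (h1.trans (h3.trans (h2.symm.trans hv.symm)))

theorem exists_mem_endComp_inter {F F' : Set V} (hF : F.Finite) (hF' : F'.Finite) :
    ∃ r, r ∈ endComp ω F ∧ r ∈ endComp ω F' := by
  obtain ⟨R, hR⟩ := ω.nonempty
  obtain ⟨N, hN⟩ := eventually_mem_endComp hF hR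
  obtain ⟨N', hN'⟩ := eventually_mem_endComp hF' hR
  exact ⟨R.f (max N N'), hN _ (le_max_left _ _), hN' _ (le_max_right _ _)⟩

theorem endComp_subset_of_boundary {F F' : Set V} (hF : F.Finite) (hF' : F'.Finite)
    (h : ∀ b ∈ F, b ∉ F' → ∀ a ∈ endComp ω F, ¬ G.Adj b a) : endComp ω F' ⊆ endComp ω F := by
  intro v hv
  obtain ⟨r, hr, hr'⟩ := exists_mem_endComp_inter (ω := ω) hF hF'
  refine (walkIn_of_mem_endComp hF' hr' hv).induct (P := (· ∈ endComp ω F))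
    (fun a b _ hb hab ha => ?_) hr
  exact mem_endComp_of_adj hab.symm (fun hbF => h b hbF hb a ha hab.symm) ha

theorem endComp_subset_of_disjoint {F F' : Set V} (hF : F.Finite) (hF' : F'.Finite)
    (h : ∀ b ∈ F, b ∉ endComp ω F') : endComp ω F' ⊆ endComp ω F := by
  intro v hv
  obtain ⟨r, hr, hr'⟩ := exists_mem_endComp_inter (ω := ω) hF hF'
  refine ((walkIn_of_mem_endComp hF' hr' hv).induct
    (P := fun x => x ∈ endComp ω F ∧ x ∈ endComp ω F') (fun a b _ hb hab ha => ?_) ⟨hr, hr'⟩).1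
  have hb' := mem_endComp_of_adj hab.symm hb ha.2
  exact ⟨mem_endComp_of_adj hab.symm (fun hbF => h b hbF hb') ha.1, hb'⟩

/-- Finitely many vertices of the component of the end lie in a common finite connected set. -/
theorem exists_finset_connected {F : Set V} (hF : F.Finite) {T : Set V} (hT : T.Finite)
    (hTC : T ⊆ endComp ω F) :
    ∃ L : Finset V, T ⊆ L ∧ ↑L ⊆ endComp ω F ∧ ∀ x ∈ L, ∀ y ∈ L, WalkIn G L x y := by
  classical
  obtain ⟨r, hr, -⟩ := exists_mem_endComp_inter (ω := ω) hF hF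
  have key : ∀ t ∈ T, ∃ K : Finset V, t ∈ K ∧ ↑K ⊆ endComp ω F ∧ ∀ x ∈ K, WalkIn G K r x := by
    intro t ht
    obtain ⟨w, hw⟩ := walkIn_of_mem_endComp hF hr (hTC ht)
    have hsub : ∀ x ∈ w.support, ∃ p : G.Walk r x, p.support ⊆ w.support :=
      fun x hx => ⟨w.takeUntil x hx, w.support_takeUntil_subset_support hx⟩
    refine ⟨w.support.toFinset, by simp, fun x hx => ?_, fun x hx => ?_⟩
    · obtain ⟨p, hp⟩ := hsub x (by simpa using hx)
      exact mem_endComp_of_walkIn (WalkIn.symm ⟨p, fun y hy => hw y (hp hy)⟩) hr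
    · obtain ⟨p, hp⟩ := hsub x (by simpa using hx)
      exact ⟨p, fun y hy => by simpa using hp hy⟩
  choose! K hK hKC hKr using key
  have base : ∀ x ∈ hT.toFinset.biUnion K, WalkIn G ↑(hT.toFinset.biUnion K) r x := by
    intro x hx
    obtain ⟨t, ht, hx⟩ := Finset.mem_biUnion.1 hx
    exact (hKr t (by simpa using ht) x hx).mono
      (Finset.coe_subset.2 (Finset.subset_biUnion_of_mem K ht))
  refine ⟨hT.toFinset.biUnion K, fun t ht => ?_, fun x hx => ?_,
    fun x hx y hy => (base x hx).symm.trans (base y hy)⟩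
  · exact Finset.mem_biUnion.2 ⟨t, by simpa using ht, hK t ht⟩
  · obtain ⟨t, ht, hx⟩ := Finset.mem_biUnion.1 hx
    exact hKC t (by simpa using ht) hx

/-- A vertex dominating `ω` has neighbours in every neighbourhood of `ω`. -/
theorem Dominates.exists_adj {v : V} (h : Dominates G v ω) {F : Set V} (hF : F.Finite) :
    ∃ u ∈ endComp ω F, G.Adj v u := by
  obtain ⟨R, hR, p, hpath, hinj, hdisj⟩ := h
  have hF' : (insert v F).Finite := hF.insert v
  obtain ⟨N, hN⟩ := eventually_mem_endComp hF' hR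
  have fin1 : {i | (p i).1 < N}.Finite :=
    (finite_Iio N).preimage (f := fun i => (p i).1) hinj.injOn
  have fin2 : {i | ∃ x ∈ F, x ≠ v ∧ x ∈ (p i).2.support}.Finite := by
    have : {i | ∃ x ∈ F, x ≠ v ∧ x ∈ (p i).2.support} =
        ⋃ x ∈ F, {i | x ≠ v ∧ x ∈ (p i).2.support} := by
      ext
      simp only [mem_ofPred_eq, mem_iUnion, exists_prop]
    rw [this]
    refine hF.biUnion fun x _ => Set.Subsingleton.finite fun i hi j hj => ?_
    by_contra hij
    exact hi.1 (hdisj i j hij x hi.2 hj.2)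
  obtain ⟨i, hi⟩ := (fin1.union fin2).exists_notMem
  simp only [mem_union, mem_ofPred_eq, not_or, not_lt, not_exists, not_and] at hi
  obtain ⟨hi1, hi2⟩ := hi
  have hend := hN _ hi1
  have hp := hpath i
  clear fin1 fin2 hi1
  revert hp hi2 hend
  generalize (p i).2 = q
  generalize R.f (p i).1 = z at *
  intro hi2 hend hp
  cases q with
  | nil => exact absurd (mem_insert _ _) (not_mem_of_mem_endComp hend)
  | @cons _ u _ hadj q =>
    refine ⟨u, endComp_anti (subset_insert v F) (mem_endComp_of_walkIn ⟨q, fun x hx => ?_⟩ hend),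
      hadj⟩
    have hv := (SimpleGraph.Walk.cons_isPath_iff _ _).1 hp
    have hxv : x ≠ v := fun h => hv.2 (h ▸ hx)
    simp only [mem_compl_iff, mem_insert_iff, not_or]
    exact ⟨hxv, fun hxF => hi2 x hxF hxv (by simp [hx])⟩

/-- A vertex not dominating `ω` can be finitely separated from it. -/
theorem exists_finite_separator {v : V} (h : ¬ Dominates G v ω) :
    ∃ F : Set V, F.Finite ∧ v ∉ F ∧ v ∉ endComp ω F := by
  classical
  by_contra! hcon
  apply h
  obtain ⟨R, hR⟩ := ω.nonempty
  obtain ⟨p, hp, hpd⟩ := exists_seq_of_forall_finset_exists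
    (fun q : (n : ℕ) × G.Walk v (R.f n) => q.2.IsPath ∧ R.f q.1 ≠ v)
    (fun q q' => ∀ x, x ∈ q.2.support → x ∈ q'.2.support → x = v) (by
      intro s _
      let F : Set V := ⋃ q ∈ s, {x | x ∈ q.2.support ∧ x ≠ v}
      have hF : F.Finite := s.finite_toSet.biUnion fun q _ =>
        (List.finite_toSet q.2.support).subset fun x hx => hx.1
      have hvF : v ∉ F := by simp [F]
      obtain ⟨N, hN⟩ := eventually_mem_endComp (ω := ω) hF hR
      obtain ⟨N', hN'⟩ := R.eventually_not_mem (finite_singleton v)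
      obtain ⟨w, hw⟩ := walkIn_of_mem_endComp hF (hcon F hF hvF) (hN _ (le_max_left N N'))
      refine ⟨⟨_, w.bypass⟩, ⟨w.bypass_isPath, hN' _ (le_max_right _ _)⟩, fun q hq x hx hx' => ?_⟩
      by_contra hxv
      refine hw x (w.support_bypass_subset_support hx') ?_
      simp only [F, mem_iUnion]
      exact ⟨q, hq, hx, hxv⟩)
  have hd : ∀ i j, i ≠ j → ∀ x, x ∈ (p i).2.support → x ∈ (p j).2.support → x = v := by
    intro i j hij x hi hj
    rcases lt_or_gt_of_ne hij with h | h
    exacts [hpd i j h x hi hj, hpd j i h x hj hi]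
  refine ⟨R, hR, p, fun i => (hp i).1, fun i j hij => ?_, hd⟩
  by_contra hne
  refine (hp i).2 (hd i j hne _ (p i).2.end_mem_support ?_)
  have hij : (p i).1 = (p j).1 := hij
  rw [hij]
  exact (p j).2.end_mem_support

end EndComponent

section Linking

variable {V : Type u} {G : SimpleGraph V}

/-- Menger's theorem in a finite vertex set `W`: the linkage is encoded as an injective map moving
vertices by at most one step, leaving `B` as soon as it is reached. -/
theorem exists_linking_of_finset {W A B : Finset V} (hA : A ⊆ W)
    (h : ∀ T : Finset V, T ⊆ W →
      (∀ a ∈ A, ∀ b ∈ B, ∀ w : G.Walk a b, (∀ x ∈ w.support, x ∈ W) → ∃ x ∈ w.support, x ∈ T) →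
      A.card ≤ T.card) :
    ∃ f : V → V, InjOn f (↑W \ ↑B) ∧ (∀ v ∈ W, v ∉ B → f v ∈ W ∧ f v ∉ A) ∧
      ∀ v, f v = v ∨ G.Adj v (f v) := by
  classical
  let t : {v // v ∈ W ∧ v ∉ B} → Finset V :=
    fun v => (W.filter fun u => u = v ∨ G.Adj v u) \ A
  have hall : ∀ X : Finset {v // v ∈ W ∧ v ∉ B}, X.card ≤ (X.biUnion t).card := by
    intro X
    let X' : Finset V := X.map (Function.Embedding.subtype _)
    have hX' : ∀ x, x ∈ X' ↔ ∃ h : x ∈ W ∧ x ∉ B, (⟨x, h⟩ : {v // v ∈ W ∧ v ∉ B}) ∈ X := by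
      intro x
      simp [X']
    have hcard : X'.card = X.card := Finset.card_map _
    have hsub : X' ⊆ X.biUnion t ∪ A := by
      intro x hx
      obtain ⟨h1, h2⟩ := (hX' x).1 hx
      by_cases hxA : x ∈ A
      · exact Finset.mem_union_right _ hxA
      · refine Finset.mem_union_left _ (Finset.mem_biUnion.2 ⟨_, h2, ?_⟩)
        simp [t, h1.1, hxA]
    have hdisj : Disjoint (X.biUnion t) A := by
      rw [Finset.disjoint_left]
      intro x hx
      obtain ⟨y, -, hy⟩ := Finset.mem_biUnion.1 hx
      exact (Finset.mem_sdiff.1 hy).2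
    have hTW : (X.biUnion t ∪ A) \ X' ⊆ W := by
      intro x hx
      rcases Finset.mem_union.1 (Finset.mem_sdiff.1 hx).1 with h | h
      · obtain ⟨y, -, hy⟩ := Finset.mem_biUnion.1 h
        exact (Finset.mem_filter.1 (Finset.mem_sdiff.1 hy).1).1
      · exact hA h
    have key := h _ hTW (by
      intro a ha b hb w hw
      by_contra! hcon
      have hwalk : WalkIn G {x | x ∈ W ∧ x ∉ (X.biUnion t ∪ A) \ X'} a b :=
        ⟨w, fun x hx => ⟨hw x hx, hcon x hx⟩⟩
      have hbX : b ∈ X' := by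
        refine hwalk.induct (P := (· ∈ X')) (fun u v _ hv huv hu => ?_) ?_
        · by_contra hvX
          refine hv.2 (Finset.mem_sdiff.2 ⟨?_, hvX⟩)
          by_cases hvA : v ∈ A
          · exact Finset.mem_union_right _ hvA
          · obtain ⟨h1, h2⟩ := (hX' u).1 hu
            refine Finset.mem_union_left _ (Finset.mem_biUnion.2 ⟨_, h2, ?_⟩)
            simp [t, hv.1, hvA, huv]
        · by_contra haX
          exact hwalk.left_mem.2 (Finset.mem_sdiff.2 ⟨Finset.mem_union_right _ ha, haX⟩)
      exact ((hX' b).1 hbX).1.2 hb)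
    rw [Finset.card_sdiff_of_subset hsub, Finset.card_union_of_disjoint hdisj] at key
    have := Finset.card_le_card hsub
    rw [Finset.card_union_of_disjoint hdisj] at this
    omega
  obtain ⟨f, hf, hft⟩ := (Finset.all_card_le_biUnion_card_iff_exists_injective t).1 hall
  have hft' : ∀ v, (f v ∈ W ∧ (f v = v ∨ G.Adj v (f v))) ∧ f v ∉ A := by
    intro v
    simpa [t] using hft v
  refine ⟨fun v => if hv : v ∈ W ∧ v ∉ B then f ⟨v, hv⟩ else v, ?_, fun v hv hvB => ?_,
    fun v => ?_⟩
  · intro x hx y hy hxy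
    have hx' : x ∈ W ∧ x ∉ B := by simpa using hx
    have hy' : y ∈ W ∧ y ∉ B := by simpa using hy
    simp only [hx', hy', not_false_eq_true, and_self, dite_true] at hxy
    simpa using hf hxy
  · simp only [hv, hvB, not_false_eq_true, and_self, dite_true]
    exact ⟨(hft' _).1.1, (hft' _).2⟩
  · by_cases hv : v ∈ W ∧ v ∉ B
    · simp only [hv, not_false_eq_true, and_self, dite_true]
      exact (hft' ⟨v, hv⟩).1.2
    · simp [hv]

/-- Menger's theorem for finite sets `A` and `B` in an arbitrary vertex set `M`. -/
theorem exists_linking {M : Set V} {A B : Finset V} (hA : ↑A ⊆ M) (hB : ↑B ⊆ M)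
    (h : ∀ T : Finset V, ↑T ⊆ M →
      (∀ a ∈ A, ∀ b ∈ B, ∀ w : G.Walk a b, (∀ x ∈ w.support, x ∈ M) → ∃ x ∈ w.support, x ∈ T) →
      A.card ≤ T.card) :
    ∃ (W : Finset V) (f : V → V), A ⊆ W ∧ B ⊆ W ∧ ↑W ⊆ M ∧ InjOn f (↑W \ ↑B) ∧
      (∀ v ∈ W, v ∉ B → f v ∈ W ∧ f v ∉ A) ∧ ∀ v, f v = v ∨ G.Adj v (f v) := by
  classical
  by_contra hcon
  let W : Finset V → Finset V := fun U => U.filter (· ∈ M) ∪ A ∪ B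
  have hAW : ∀ U, A ⊆ W U := fun U x hx => by simp [W, hx]
  have hBW : ∀ U, B ⊆ W U := fun U x hx => by simp [W, hx]
  have hWM : ∀ U, (W U : Set V) ⊆ M := by
    intro U x hx
    simp only [W, Finset.coe_union, Finset.coe_filter, mem_union, mem_ofPred_eq] at hx
    rcases hx with (hx | hx) | hx
    exacts [hx.2, hA hx, hB hx]
  have hT : ∀ U, ∃ T : Finset V, T ⊆ W U ∧ (∀ a ∈ A, ∀ b ∈ B, ∀ w : G.Walk a b,
      (∀ x ∈ w.support, x ∈ W U) → ∃ x ∈ w.support, x ∈ T) ∧ T.card < A.card := by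
    intro U
    by_contra! hU
    obtain ⟨f, h1, h2, h3⟩ := exists_linking_of_finset (hAW U) hU
    exact hcon ⟨W U, f, hAW U, hBW U, hWM U, h1, h2, h3⟩
  choose T hTW hTsep hTcard using hT
  let 𝒰 : Ultrafilter (Finset V) := Ultrafilter.of Filter.atTop
  have hle : (𝒰 : Filter (Finset V)) ≤ Filter.atTop := Ultrafilter.of_le _
  let L : Set V := {v | ∀ᶠ U in (𝒰 : Filter (Finset V)), v ∈ T U}
  have hL : ∀ K : Finset V, ↑K ⊆ L → K.card < A.card := by
    intro K hK
    have : ∀ᶠ U in (𝒰 : Filter (Finset V)), ∀ v ∈ K, v ∈ T U :=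
      (Filter.eventually_all_finset K).2 fun v hv => hK hv
    obtain ⟨U, hU⟩ := this.exists
    exact (Finset.card_le_card hU).trans_lt (hTcard U)
  have hLfin : L.Finite := by
    by_contra hinf
    obtain ⟨K, hK, hKc⟩ := Set.Infinite.exists_subset_card_eq hinf A.card
    exact (hL K hK).ne hKc
  refine absurd (hL hLfin.toFinset (by simp)) (not_lt.2 (h _ (fun v hv => ?_) ?_))
  · obtain ⟨U, hU⟩ := (show v ∈ L from hLfin.mem_toFinset.1 hv).exists
    exact hWM U (hTW U hU)
  · intro a ha b hb w hw
    have hev : ∀ᶠ U in (𝒰 : Filter (Finset V)), ∃ x ∈ {x | x ∈ w.support}, x ∈ T U := by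
      filter_upwards [hle (Filter.eventually_ge_atTop w.support.toFinset)] with U hU
      refine hTsep U a ha b hb w fun x hx => ?_
      have : x ∈ U := hU (by simpa using hx)
      simp [W, this, hw x hx]
    obtain ⟨x, hx, hxL⟩ := (Ultrafilter.eventually_exists_mem_iff (List.finite_toSet _)).1 hev
    exact ⟨x, hx, by simpa [L] using hxL⟩

end Linking

section Rays

variable {V : Type u} {G : SimpleGraph V} {ω : GraphEnd G} {D : Set V}

/-- Modulo `D`, the set `T` separates `Z` from the end `ω` and is disjoint from `Z`. -/
structure IsEndSeparator (ω : GraphEnd G) (D : Set V) (Z T : Finset V) : Prop where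
  not_mem : ∀ t ∈ T, t ∉ Z ∧ t ∉ D
  sep : ∀ z ∈ Z, z ∉ endComp ω (↑T ∪ D)

theorem exists_isEndSeparator (hDfin : D.Finite) (hD : ∀ v ∉ D, ¬ Dominates G v ω)
    {Z : Finset V} (hZ : ∀ z ∈ Z, z ∉ D) : ∃ T, IsEndSeparator ω D Z T := by
  classical
  have key : ∀ z ∈ Z, ∃ F : Set V, F.Finite ∧ z ∉ F ∧ z ∉ endComp ω F :=
    fun z hz => exists_finite_separator (hD z (hZ z hz))
  choose! F hFfin hzF hzC using key
  let E : Set V := (⋃ z ∈ Z, F z) ∪ ↑Z ∪ D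
  have hE : E.Finite := ((Z.finite_toSet.biUnion hFfin).union Z.finite_toSet).union hDfin
  have hFE : ∀ z ∈ Z, F z ⊆ E := fun z hz x hx =>
    Or.inl (Or.inl (mem_iUnion₂.2 ⟨z, hz, hx⟩))
  have hT : {t ∈ E \ D | ∃ a ∈ endComp ω E, G.Adj t a}.Finite := hE.subset fun t ht => ht.1.1
  refine ⟨hT.toFinset, fun t ht => ?_, fun z hz hzT => ?_⟩
  · obtain ⟨ht, a, ha, hta⟩ := hT.mem_toFinset.1 ht
    exact ⟨fun htZ => hzC t htZ (mem_endComp_of_adj hta (hzF t htZ) (endComp_anti (hFE t htZ) ha)),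
      ht.2⟩
  · rw [Finite.coe_toFinset] at hzT
    have := endComp_subset_of_boundary hE (hT.union hDfin) (fun b hb hb' a ha hba =>
      hb' (Or.inl ⟨⟨hb, fun h => hb' (Or.inr h)⟩, a, ha, hba⟩)) hzT
    exact not_mem_of_mem_endComp this (Or.inl (Or.inr hz))

theorem IsEndSeparator.exists_adj (hDfin : D.Finite) {Z S : Finset V}
    (hS : IsEndSeparator ω D Z S) (hmin : ∀ T, IsEndSeparator ω D Z T → S.card ≤ T.card)
    {s : V} (hs : s ∈ S) : ∃ a ∈ endComp ω (↑S ∪ D), G.Adj s a := by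
  classical
  by_contra! hcon
  refine (Finset.card_erase_lt_of_mem hs).not_ge (hmin (S.erase s)
    ⟨fun t ht => hS.not_mem t (Finset.mem_of_mem_erase ht), fun z hz hzT => hS.sep z hz ?_⟩)
  refine endComp_subset_of_boundary (S.finite_toSet.union hDfin)
    ((S.erase s).finite_toSet.union hDfin) (fun b hb hb' a ha hba => ?_) hzT
  have hbs : b = s := by
    rcases hb with hb | hb
    · by_contra hne
      exact hb' (Or.inl (by simpa [hne] using hb))
    · exact absurd (Or.inr hb) hb'
  exact hcon a ha (hbs ▸ hba)

theorem IsEndSeparator.exists_layer (hDfin : D.Finite) {Z S : Finset V}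
    (hS : IsEndSeparator ω D Z S) (hmin : ∀ T, IsEndSeparator ω D Z T → S.card ≤ T.card)
    {R : GraphRay G} (hR : R ∈ ω.rays) :
    ∃ L : Finset V, ↑L ⊆ endComp ω (↑S ∪ D) ∧
      ∀ s ∈ S, ∃ m, WalkIn G (↑S ∪ ↑L) (R.f m) s := by
  have key : ∀ s ∈ S, ∃ a ∈ endComp ω (↑S ∪ D), G.Adj s a :=
    fun s hs => hS.exists_adj hDfin hmin hs
  choose! a ha hadj using key
  have hfin : (↑S ∪ D).Finite := S.finite_toSet.union hDfin
  obtain ⟨N, hN⟩ := eventually_mem_endComp hfin hR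
  obtain ⟨L, hTL, hLC, hL⟩ := exists_finset_connected hfin
    (T := insert (R.f N) (a '' S)) ((S.finite_toSet.image a).insert _) (by
      rintro x (rfl | ⟨s, hs, rfl⟩)
      exacts [hN N le_rfl, ha s hs])
  refine ⟨L, hLC, fun s hs => ⟨N, ?_⟩⟩
  have has : a s ∈ L := hTL (Or.inr ⟨s, hs, rfl⟩)
  exact ((hL _ (hTL (Or.inl rfl)) _ has).mono subset_union_right).trans
    (.of_adj (hadj s hs).symm (Or.inr has) (Or.inl hs))

/-- The data of a sequence of minimum separators converging to `ω`. -/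
structure SeparatorSequence (ω : GraphEnd G) (D : Set V) (R : GraphRay G)
    (Z S L : ℕ → Finset V) : Prop where
  isSep : ∀ i, IsEndSeparator ω D (Z i) (S i)
  card_le : ∀ i T, IsEndSeparator ω D (Z i) T → (S i).card ≤ T.card
  layer_subset : ∀ i, ↑(L i) ⊆ endComp ω (↑(S i) ∪ D)
  layer : ∀ i, ∀ s ∈ S i, ∃ m, WalkIn G (↑(S i) ∪ ↑(L i)) (R.f m) s
  subset_succ : ∀ i, Z i ⊆ Z (i + 1)
  sep_subset_succ : ∀ i, S i ⊆ Z (i + 1)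
  layer_subset_succ : ∀ i, L i ⊆ Z (i + 1)

theorem exists_separatorSequence (hDfin : D.Finite) (hD : ∀ v ∉ D, ¬ Dominates G v ω)
    {R : GraphRay G} (hR : R ∈ ω.rays) {Z₀ : Finset V} (hZ₀ : ∀ z ∈ Z₀, z ∉ D) :
    ∃ Z S L, Z 0 = Z₀ ∧ SeparatorSequence ω D R Z S L := by
  classical
  have key : ∀ Z : {Z : Finset V // ∀ z ∈ Z, z ∉ D}, ∃ S L : Finset V,
      IsEndSeparator ω D Z S ∧ (∀ T, IsEndSeparator ω D Z T → S.card ≤ T.card) ∧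
      ↑L ⊆ endComp ω (↑S ∪ D) ∧ ∀ s ∈ S, ∃ m, WalkIn G (↑S ∪ ↑L) (R.f m) s := by
    intro Z
    have hex : ∃ n T, IsEndSeparator ω D Z.1 T ∧ T.card = n := by
      obtain ⟨T, hT⟩ := exists_isEndSeparator hDfin hD Z.2
      exact ⟨_, T, hT, rfl⟩
    obtain ⟨S, hS, hSc⟩ := Nat.find_spec hex
    have hmin : ∀ T, IsEndSeparator ω D Z T → S.card ≤ T.card := fun T hT =>
      hSc ▸ Nat.find_min' hex ⟨T, hT, rfl⟩
    obtain ⟨L, h1, h2⟩ := hS.exists_layer hDfin hmin hR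
    exact ⟨S, L, hS, hmin, h1, h2⟩
  choose S L hS hmin hL hlayer using key
  let next : {Z : Finset V // ∀ z ∈ Z, z ∉ D} → {Z : Finset V // ∀ z ∈ Z, z ∉ D} := fun Z =>
    ⟨Z.1 ∪ S Z ∪ L Z, fun z hz => by
      rcases Finset.mem_union.1 hz with hz | hz
      · rcases Finset.mem_union.1 hz with hz | hz
        exacts [Z.2 z hz, ((hS Z).not_mem z hz).2]
      · exact fun hzD => not_mem_of_mem_endComp (hL Z hz) (Or.inr hzD)⟩
  let Z : ℕ → {Z : Finset V // ∀ z ∈ Z, z ∉ D} := fun n => Nat.rec ⟨Z₀, hZ₀⟩ (fun _ => next) n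
  refine ⟨fun i => (Z i).1, fun i => S (Z i), fun i => L (Z i), rfl,
    fun i => hS _, fun i => hmin _, fun i => hL _, fun i => hlayer _, fun i => ?_, fun i => ?_,
    fun i => ?_⟩ <;> intro x hx <;> show x ∈ (Z i).1 ∪ S (Z i) ∪ L (Z i) <;> simp [hx]

namespace SeparatorSequence

variable {R : GraphRay G} {Z S L : ℕ → Finset V}

theorem subset_of_le (h : SeparatorSequence ω D R Z S L) {i j : ℕ} (hij : i ≤ j) : Z i ⊆ Z j :=
  monotone_nat_of_le_succ h.subset_succ hij

theorem endComp_succ_subset (h : SeparatorSequence ω D R Z S L) (hD : D.Finite) (i : ℕ) :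
    endComp ω (↑(S (i + 1)) ∪ D) ⊆ endComp ω (↑(S i) ∪ D) := by
  refine endComp_subset_of_disjoint ((S i).finite_toSet.union hD)
    ((S (i + 1)).finite_toSet.union hD) ?_
  rintro b (hb | hb) hbC
  · exact (h.isSep (i + 1)).sep b (h.sep_subset_succ i hb) hbC
  · exact not_mem_of_mem_endComp hbC (Or.inr hb)

theorem endComp_anti (h : SeparatorSequence ω D R Z S L) (hD : D.Finite) {i j : ℕ} (hij : i ≤ j) :
    endComp ω (↑(S j) ∪ D) ⊆ endComp ω (↑(S i) ∪ D) :=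
  antitone_nat_of_succ_le (f := fun i => endComp ω (↑(S i) ∪ D)) (h.endComp_succ_subset hD) hij

theorem sep_succ_subset (h : SeparatorSequence ω D R Z S L) (hD : D.Finite) (i : ℕ) :
    ↑(S (i + 1)) ⊆ endComp ω (↑(S i) ∪ D) := by
  intro s hs
  obtain ⟨a, ha, hsa⟩ := (h.isSep (i + 1)).exists_adj hD (h.card_le (i + 1)) hs
  refine mem_endComp_of_adj hsa ?_ (h.endComp_succ_subset hD i ha)
  rintro (hs' | hs')
  · exact ((h.isSep (i + 1)).not_mem s hs).1 (h.sep_subset_succ i hs')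
  · exact ((h.isSep (i + 1)).not_mem s hs).2 hs'

theorem exists_linking (h : SeparatorSequence ω D R Z S L) (hD : D.Finite) (i : ℕ) :
    ∃ (W : Finset V) (f : V → V), S i ⊆ W ∧ S (i + 1) ⊆ W ∧
      ↑W ⊆ (endComp ω (↑(S i) ∪ D) ∪ ↑(S i)) \ endComp ω (↑(S (i + 1)) ∪ D) ∧
      InjOn f (↑W \ ↑(S (i + 1))) ∧
      (∀ v ∈ W, v ∉ S (i + 1) → f v ∈ W ∧ f v ∉ S i) ∧ ∀ v, f v = v ∨ G.Adj v (f v) := by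
  set M := (endComp ω (↑(S i) ∪ D) ∪ ↑(S i)) \ endComp ω (↑(S (i + 1)) ∪ D) with hM
  have hSi : ↑(S i) ⊆ M := fun s hs =>
    ⟨Or.inr hs, (h.isSep (i + 1)).sep s (h.sep_subset_succ i hs)⟩
  have hSi' : ↑(S (i + 1)) ⊆ M := fun s hs =>
    ⟨Or.inl (h.sep_succ_subset hD i hs), fun hs' => not_mem_of_mem_endComp hs' (Or.inl hs)⟩
  refine _root_.exists_linking hSi hSi' fun T hTM hT => h.card_le i T ⟨fun t ht => ?_, ?_⟩
  · rcases (hTM ht).1 with ht' | ht'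
    · exact ⟨fun htZ => (h.isSep i).sep t htZ ht',
        fun htD => not_mem_of_mem_endComp ht' (Or.inr htD)⟩
    · exact (h.isSep i).not_mem t ht'
  · intro z hz hzT
    obtain ⟨r, hr, hr'⟩ := exists_mem_endComp_inter (ω := ω) (T.finite_toSet.union hD)
      ((S (i + 1)).finite_toSet.union hD)
    have hwalk := walkIn_of_mem_endComp (T.finite_toSet.union hD) hzT hr
    have hinv : r ∉ endComp ω (↑(S i) ∪ D) ∨ ∃ s ∈ S i, WalkIn G (M \ ↑T) s r := by
      refine hwalk.induct (P := fun u => u ∉ endComp ω (↑(S i) ∪ D) ∨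
        ∃ s ∈ S i, WalkIn G (M \ ↑T) s u) (fun u v huT hvT huv hu => ?_)
        (Or.inl ((h.isSep i).sep z hz))
      have huT' : u ∉ T := fun h => huT (Or.inl h)
      have hvT' : v ∉ T := fun h => hvT (Or.inl h)
      have huD : u ∉ D := fun h => huT (Or.inr h)
      by_cases hv : v ∈ endComp ω (↑(S i) ∪ D)
      · right
        have hu' : ∃ s ∈ S i, WalkIn G (M \ ↑T) s u := by
          rcases hu with hu | hu
          · have huS : u ∈ S i := by
              by_contra huS
              exact hu (mem_endComp_of_adj huv (by simp [huS, huD]) hv)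
            exact ⟨u, huS, .refl ⟨hSi huS, huT'⟩⟩
          · exact hu
        obtain ⟨s, hs, hsu⟩ := hu'
        have huS' : u ∉ S (i + 1) := by
          intro huS'
          obtain ⟨w, hw⟩ := hsu
          obtain ⟨x, hx, hxT⟩ := hT s hs u huS' w fun x hx => (hw x hx).1
          exact (hw x hx).2 hxT
        have hvM : v ∈ M := ⟨Or.inl hv, fun hv' => hsu.right_mem.1.2
          (mem_endComp_of_adj huv (by simp [huS', huD]) hv')⟩
        exact ⟨s, hs, hsu.trans (.of_adj huv hsu.right_mem ⟨hvM, hvT'⟩)⟩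
      · exact Or.inl hv
    rcases hinv with hinv | ⟨s, -, hs⟩
    · exact hinv (h.endComp_succ_subset hD i hr')
    · exact hs.right_mem.1.2 hr'

end SeparatorSequence

theorem iterate_eq_iterate_iff {P S : Set V} {F : V → V} (hSP : S ⊆ P)
    (hF : ∀ v ∈ P, F v ∈ P ∧ F v ∉ S) (hinj : InjOn F P) {s s' : V} (hs : s ∈ S) (hs' : s' ∈ S)
    {m n : ℕ} (h : F^[m] s = F^[n] s') : m = n ∧ s = s' := by
  have hmem : ∀ n, ∀ v ∈ P, F^[n] v ∈ P := by
    intro n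
    induction n with
    | zero => exact fun v hv => hv
    | succ n ih => exact fun v hv => ih _ (hF v hv).1
  induction m generalizing n with
  | zero =>
    cases n with
    | zero => exact ⟨rfl, h⟩
    | succ n =>
      rw [Function.iterate_succ_apply'] at h
      have h' : s = F (F^[n] s') := h
      rw [h'] at hs
      exact absurd hs (hF _ (hmem n s' (hSP hs'))).2
  | succ m ih =>
    cases n with
    | zero =>
      rw [Function.iterate_succ_apply'] at h
      have h' : F (F^[m] s) = s' := h
      rw [← h'] at hs'
      exact absurd hs' (hF _ (hmem m s (hSP hs))).2
    | succ n =>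
      rw [Function.iterate_succ_apply', Function.iterate_succ_apply'] at h
      obtain ⟨h1, h2⟩ := ih (hinj (hmem m s (hSP hs)) (hmem n s' (hSP hs')) h)
      exact ⟨by rw [h1], h2⟩

/-- A sequence of pairwise disjoint sets eventually leaves every finite set. -/
theorem exists_disjoint_of_pairwise_disjoint {K : ℕ → Set V}
    (hK : ∀ i j, i < j → Disjoint (K i) (K j)) {F : Set V} (hF : F.Finite) :
    ∃ i, Disjoint (K i) F := by
  by_contra! h
  have : ∀ i, ∃ x, x ∈ K i ∧ x ∈ F := fun i => Set.not_disjoint_iff.1 (h i)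
  choose x hx hxF using this
  refine infinite_univ (α := ℕ) (Finite.of_finite_image (f := x)
    (hF.subset (by rintro _ ⟨i, -, rfl⟩; exact hxF i)) fun i _ j _ hij => ?_)
  rcases lt_trichotomy i j with h | h | h
  · exact absurd (hij ▸ hx j) (Set.disjoint_left.1 (hK i j h) (hx i))
  · exact h
  · exact absurd (hij ▸ hx j) (Set.disjoint_right.1 (hK j i h) (hx i))

theorem SeparatorSequence.degGE {R : GraphRay G} {Z S L : ℕ → Finset V}
    (h : SeparatorSequence ω D R Z S L) (hD : D.Finite) (hR : R ∈ ω.rays) :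
    DegGE G ω (S 0).card := by
  classical
  choose W f hSW hSW' hWM hinj hmaps hstep using h.exists_linking hD
  have hlater : ∀ i j, i < j → ∀ v ∈ W j,
      v ∈ endComp ω (↑(S (i + 1)) ∪ D) ∨ v ∈ S (i + 1) := by
    intro i j hij v hv
    rcases (hWM j hv).1 with hv | hv
    · exact Or.inl (h.endComp_anti hD hij hv)
    · obtain rfl | hlt := Nat.eq_or_lt_of_le hij
      · exact Or.inr hv
      · obtain ⟨j, rfl⟩ : ∃ j', j = j' + 1 := ⟨j - 1, by omega⟩
        exact Or.inl (h.endComp_anti hD (by omega) (h.sep_succ_subset hD j hv))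
  have huniq : ∀ i j v, v ∈ W i → v ∉ S (i + 1) → v ∈ W j → v ∉ S (j + 1) → i = j := by
    have aux : ∀ i j v, v ∈ W i → v ∉ S (i + 1) → v ∈ W j → ¬ i < j := fun i j v hi hi' hj hij =>
      (hlater i j hij v hj).elim (hWM i hi).2 hi'
    intro i j v hi hi' hj hj'
    exact le_antisymm (not_lt.1 (aux j i v hj hj' hi)) (not_lt.1 (aux i j v hi hi' hj))
  have huniq' : ∀ i j v, v ∈ W i → v ∉ S i → v ∈ W j → v ∉ S j → i = j := by
    have aux : ∀ i j v, v ∈ W i → v ∈ W j → v ∉ S j → ¬ i < j := fun i j v hi hj hj' hij =>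
      (hWM i hi).2 (h.endComp_anti hD hij ((hWM j hj).1.resolve_right hj'))
    intro i j v hi hi' hj hj'
    exact le_antisymm (not_lt.1 (aux j i v hj hi hi')) (not_lt.1 (aux i j v hi hj hj'))
  have hSS : ∀ i, ∀ s ∈ S i, s ∉ S (i + 1) := fun i s hs hs' =>
    ((h.isSep (i + 1)).not_mem s hs').1 (h.sep_subset_succ i hs)
  let F : V → V := fun v => if hv : ∃ i, v ∈ W i ∧ v ∉ S (i + 1) then f hv.choose v else v
  have hFf : ∀ i v, v ∈ W i → v ∉ S (i + 1) → F v = f i v := by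
    intro i v hv hv'
    have hex : ∃ i, v ∈ W i ∧ v ∉ S (i + 1) := ⟨i, hv, hv'⟩
    have hi : hex.choose = i := huniq _ _ v hex.choose_spec.1 hex.choose_spec.2 hv hv'
    simp only [F, hex, dite_true, hi]
  have hFadj : ∀ v, F v = v ∨ G.Adj v (F v) := by
    intro v
    by_cases hv : ∃ i, v ∈ W i ∧ v ∉ S (i + 1)
    · obtain ⟨i, hi, hi'⟩ := hv
      rw [hFf i v hi hi']
      exact hstep i v
    · simp [F, hv]
  let P : Set V := {v | ∃ i, v ∈ W i ∧ v ∉ S (i + 1)}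
  have hSP : ∀ i, ↑(S i) ⊆ P := fun i s hs => ⟨i, hSW i hs, hSS i s hs⟩
  have hFP : ∀ v ∈ P, F v ∈ P ∧ F v ∉ S 0 := by
    rintro v ⟨i, hi, hi'⟩
    rw [hFf i v hi hi']
    obtain ⟨h1, h2⟩ := hmaps i v hi hi'
    constructor
    · by_cases h3 : f i v ∈ S (i + 1)
      · exact hSP _ h3
      · exact ⟨i, h1, h3⟩
    · intro h3
      have h4 := huniq i 0 (f i v) h1 ?_ (hSW 0 h3) (hSS 0 _ h3)
      · subst h4
        exact h2 h3
      · intro h4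
        exact ((h.isSep (i + 1)).not_mem _ h4).1
          (h.subset_of_le (by omega : 1 ≤ i + 1) (h.sep_subset_succ 0 h3))
  have hFinj : InjOn F P := by
    rintro v ⟨i, hi, hi'⟩ w ⟨j, hj, hj'⟩ hvw
    rw [hFf i v hi hi', hFf j w hj hj'] at hvw
    obtain ⟨h1, h2⟩ := hmaps i v hi hi'
    obtain ⟨h3, h4⟩ := hmaps j w hj hj'
    rw [← hvw] at h3 h4
    obtain rfl := huniq' i j _ h1 h2 h3 h4
    exact hinj i ⟨hi, hi'⟩ ⟨hj, hj'⟩ hvw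
  have horbit : ∀ {s s' : V}, s ∈ S 0 → s' ∈ S 0 → ∀ {m n : ℕ}, F^[m] s = F^[n] s' →
      m = n ∧ s = s' := fun hs hs' _ _ hmn => iterate_eq_iterate_iff (hSP 0) hFP hFinj hs hs' hmn
  let ray : S 0 → GraphRay G := fun s =>
    { f := fun n => F^[n] s.1
      inj := fun m n hmn => (horbit s.2 s.2 hmn).1
      adj := fun n => by
        have := hFadj (F^[n] s.1)
        rw [← Function.iterate_succ_apply' F n s.1] at this
        refine this.resolve_left fun heq => ?_
        have := (horbit s.2 s.2 heq).1
        omega }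
  have hhit : ∀ (s : S 0) i, ∃ n, (ray s).f n ∈ S i := by
    intro s i
    induction i with
    | zero => exact ⟨0, s.2⟩
    | succ i ih =>
      obtain ⟨n, hn⟩ := ih
      by_contra! hcon
      have hall : ∀ t, (ray s).f (n + t) ∈ W i := by
        intro t
        induction t with
        | zero => exact hSW i hn
        | succ t iht =>
          have : (ray s).f (n + (t + 1)) = F ((ray s).f (n + t)) :=
            Function.iterate_succ_apply' F (n + t) s.1
          rw [this, hFf i _ iht (hcon _)]
          exact (hmaps i _ iht (hcon _)).1
      obtain ⟨N, hN⟩ := (ray s).eventually_not_mem (W i).finite_toSet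
      exact hN (n + N) (by omega) (hall N)
  have hdisj : ∀ i j, i < j → Disjoint (↑(S i) ∪ ↑(L i) : Set V) (↑(S j) ∪ ↑(L j)) := by
    intro i j hij
    rw [Set.disjoint_left]
    intro x hx hx'
    have hxZ : x ∈ Z j := h.subset_of_le hij
      (hx.elim (fun hx => h.sep_subset_succ i hx) fun hx => h.layer_subset_succ i hx)
    rcases hx' with hx' | hx'
    · exact ((h.isSep j).not_mem x hx').1 hxZ
    · exact (h.isSep j).sep x hxZ (h.layer_subset j hx')
  have hray : ∀ s, ray s ∈ ω.rays := by
    intro s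
    refine (ω.mem_iff R hR (ray s)).2 fun E hE => ?_
    obtain ⟨i, hi⟩ := exists_disjoint_of_pairwise_disjoint hdisj hE
    obtain ⟨n, hn⟩ := hhit s i
    obtain ⟨m, w, hw⟩ := h.layer i _ hn
    exact ⟨m, n, w, fun x hx => Set.disjoint_left.1 hi (hw x hx)⟩
  refine ⟨fun i => ray ((S 0).equivFin.symm i), fun i => hray _, fun i j hij => ?_⟩
  rw [Set.disjoint_left]
  rintro _ ⟨m, rfl⟩ ⟨n, hn⟩
  have := (horbit (Subtype.prop _) (Subtype.prop _) hn).2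
  exact hij ((S 0).equivFin.symm.injective (Subtype.ext this)).symm

theorem degGE_mono {m n : ℕ} (hmn : m ≤ n) (h : DegGE G ω n) : DegGE G ω m := by
  obtain ⟨R, hR, hd⟩ := h
  exact ⟨fun i => R (Fin.castLE hmn i), fun i => hR _, fun i j hij =>
    hd _ _ fun h => hij (Fin.castLE_injective hmn h)⟩

/-- If `deg(ω) + dom(ω) < k` and `D` is the set of vertices dominating `ω`, then every finite set
is separated from `ω` by fewer than `k` vertices in such a way that it meets the separator exactly
in vertices of `D`. -/
theorem exists_small_endSeparator {D : Finset V} (hD : ∀ v, v ∈ D ↔ Dominates G v ω) {k : ℕ}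
    (hk : ¬ DegDomGE G ω k) (hDk : D.card ≤ k) {Z : Finset V} (hZ : ∀ z ∈ Z, z ∉ D) :
    ∃ T, IsEndSeparator ω D Z T ∧ T.card + D.card < k := by
  by_contra! hcon
  obtain ⟨R, hR⟩ := ω.nonempty
  obtain ⟨Z', S, L, rfl, h⟩ := exists_separatorSequence (D := ↑D) D.finite_toSet
    (fun v hv hdom => hv ((hD v).2 hdom)) hR hZ
  have hcard := hcon _ (h.isSep 0)
  exact hk ⟨k - D.card, D.card, by omega,
    degGE_mono (by omega) (h.degGE D.finite_toSet hR), D, rfl, fun v hv => (hD v).1 hv⟩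

end Rays

section Tangle

variable {V : Type u} {G : SimpleGraph V} {ω : GraphEnd G}

namespace FinSep

theorem mem_or (s : FinSep G) (v : V) : v ∈ s.1.A ∨ v ∈ s.1.B := by
  have : v ∈ s.1.A ∪ s.1.B := s.1.union_eq ▸ mem_univ v
  exact this

theorem mem_A_diff_of_adj (s : FinSep G) {u v : V} (h : G.Adj u v) (hu : u ∈ s.1.A \ s.1.B)
    (hv : v ∉ s.1.A ∩ s.1.B) : v ∈ s.1.A \ s.1.B := by
  rcases s.mem_or v with hvA | hvB
  · exact ⟨hvA, fun hvB => hv ⟨hvA, hvB⟩⟩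
  · exact absurd h (s.1.no_edge u hu v ⟨hvB, fun hvA => hv ⟨hvA, hvB⟩⟩)

theorem mem_A_of_adj (s : FinSep G) {u v : V} (h : G.Adj u v) (hu : u ∈ s.1.A \ s.1.B) :
    v ∈ s.1.A := by
  by_cases hv : v ∈ s.1.A ∩ s.1.B
  · exact hv.1
  · exact (s.mem_A_diff_of_adj h hu hv).1

theorem mem_A_diff_of_walkIn (s : FinSep G) {u v : V} {S : Set V} (h : WalkIn G S u v)
    (hS : Disjoint S (s.1.A ∩ s.1.B)) (hu : u ∈ s.1.A \ s.1.B) : v ∈ s.1.A \ s.1.B :=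
  h.induct (P := (· ∈ s.1.A \ s.1.B))
    (fun _ _ _ hb hab ha => s.mem_A_diff_of_adj hab ha (Set.disjoint_left.1 hS hb)) hu

end FinSep

theorem endComp_subset_of_mem_endTangle {s : FinSep G} (hs : s ∈ endTangle ω) :
    endComp ω (s.1.A ∩ s.1.B) ⊆ s.1.B \ s.1.A := by
  rintro v ⟨R, hR, n, hn, hv⟩
  obtain ⟨N, hN⟩ := hs R hR
  have hR' : WalkIn G (s.1.A ∩ s.1.B)ᶜ (R.f n) (R.f (max n N)) :=
    R.walkIn (le_max_left _ _) fun i hi _ => hn i hi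
  have hend : R.f (max n N) ∈ s.rev.1.A \ s.rev.1.B :=
    ⟨hN _ (le_max_right _ _), fun hA => hn _ (le_max_left _ _) ⟨hA, hN _ (le_max_right _ _)⟩⟩
  exact s.rev.mem_A_diff_of_walkIn (hv.trans hR').symm
    (by rw [Set.inter_comm]; exact disjoint_compl_left) hend

theorem rev_mem_endTangle {s : FinSep G} (hs : s ∉ endTangle ω) : s.rev ∈ endTangle ω := by
  intro R hR
  obtain ⟨N, hN⟩ := eventually_mem_endComp s.2 hR
  refine ⟨N, fun n hn => ?_⟩
  show R.f n ∈ s.1.A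
  by_contra hA
  apply hs
  intro R' hR'
  obtain ⟨N', hN'⟩ := eventually_mem_endComp s.2 hR'
  refine ⟨N', fun n' hn' => ?_⟩
  have := s.rev.mem_A_diff_of_walkIn (walkIn_of_mem_endComp s.2 (hN n hn) (hN' n' hn'))
    (by rw [Set.inter_comm]; exact disjoint_compl_left) ⟨(s.mem_or _).resolve_left hA, hA⟩
  exact this.1

theorem Dominates.mem_B {v : V} (h : Dominates G v ω) {s : FinSep G} (hs : s ∈ endTangle ω) :
    v ∈ s.1.B := by
  obtain ⟨u, hu, hvu⟩ := h.exists_adj s.2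
  exact s.rev.mem_A_of_adj hvu.symm (endComp_subset_of_mem_endTangle hs hu)

/-- The separation with small side everything outside the component of `G - F` containing `ω`. -/
def endCompSep (ω : GraphEnd G) (F : Set V) (hF : F.Finite) : FinSep G :=
  ⟨{ A := (endComp ω F)ᶜ
     B := F ∪ endComp ω F
     union_eq := by
      ext v
      by_cases h : v ∈ endComp ω F <;> simp [h]
     no_edge := fun a ha b hb hab =>
      ha.1 (mem_endComp_of_adj hab (fun h => ha.2 (Or.inl h)) (not_not.1 hb.2)) },
   hF.subset fun _ hv => hv.2.resolve_right hv.1⟩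

theorem endCompSep_mem_endTangle {F : Set V} (hF : F.Finite) :
    endCompSep ω F hF ∈ endTangle ω := by
  intro R hR
  obtain ⟨N, hN⟩ := eventually_mem_endComp hF hR
  exact ⟨N, fun n hn => Or.inr (hN n hn)⟩

theorem ncard_endCompSep_le {F : Set V} (hF : F.Finite) :
    ((endCompSep ω F hF).1.A ∩ (endCompSep ω F hF).1.B).ncard ≤ F.ncard :=
  ncard_le_ncard (fun _ hv => hv.2.resolve_right hv.1) hF

theorem exists_finite_of_isOpen {O : Set (FinSep G)} (hO : IsOpen O) {s : FinSep G} (hs : s ∈ O) :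
    ∃ Z : Set V, Z.Finite ∧ ∀ t : FinSep G,
      t.1.A ∩ Z = s.1.A ∩ Z → t.1.B ∩ Z = s.1.B ∩ Z → t ∈ O := by
  induction hO with
  | basic O hO =>
    obtain ⟨Z, AZ, BZ, hZ, rfl⟩ := hO
    exact ⟨Z, hZ, fun t h1 h2 => ⟨h1.trans hs.1, h2.trans hs.2⟩⟩
  | univ => exact ⟨∅, finite_empty, fun _ _ _ => mem_univ _⟩
  | inter O₁ O₂ _ _ ih₁ ih₂ =>
    obtain ⟨Z₁, hZ₁, h₁⟩ := ih₁ hs.1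
    obtain ⟨Z₂, hZ₂, h₂⟩ := ih₂ hs.2
    have aux : ∀ {X Y Z Z' : Set V}, Z' ⊆ Z → X ∩ Z = Y ∩ Z → X ∩ Z' = Y ∩ Z' := by
      intro X Y Z Z' hZ h
      rw [← inter_eq_self_of_subset_right hZ, ← inter_assoc, ← inter_assoc, h]
    exact ⟨Z₁ ∪ Z₂, hZ₁.union hZ₂, fun t hA hB =>
      ⟨h₁ t (aux subset_union_left hA) (aux subset_union_left hB),
        h₂ t (aux subset_union_right hA) (aux subset_union_right hB)⟩⟩
  | sUnion 𝒪 _ ih =>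
    obtain ⟨O, hO, hsO⟩ := hs
    obtain ⟨Z, hZ, h⟩ := ih O hO hsO
    exact ⟨Z, hZ, fun t hA hB => ⟨O, hO, h t hA hB⟩⟩

theorem isClosed_of_decider {k : ℕ} {X : Finset V}
    (hX : ∀ s ∈ endTangle ω, (s.1.A ∩ s.1.B).ncard < k →
      (s.1.A ∩ ↑X).ncard < (s.1.B ∩ ↑X).ncard) :
    IsClosed {s : FinSep G | s ∈ endTangle ω ∧ (s.1.A ∩ s.1.B).ncard < k} := by
  rw [← isOpen_compl_iff, isOpen_iff_forall_mem_open]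
  intro s hs
  let Z : Set V := (s.1.A ∩ s.1.B) ∪ ↑X
  refine ⟨{t | t.1.A ∩ Z = s.1.A ∩ Z ∧ t.1.B ∩ Z = s.1.B ∩ Z}, ?_,
    TopologicalSpace.isOpen_generateFrom_of_mem
      ⟨Z, _, _, s.2.union X.finite_toSet, rfl⟩, ⟨rfl, rfl⟩⟩
  rintro t ⟨hA, hB⟩ ⟨ht, htk⟩
  have hAZ : ∀ v ∈ Z, (v ∈ t.1.A ↔ v ∈ s.1.A) := fun v hv => by
    have := Set.ext_iff.1 hA v
    simpa [hv] using this
  have hBZ : ∀ v ∈ Z, (v ∈ t.1.B ↔ v ∈ s.1.B) := fun v hv => by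
    have := Set.ext_iff.1 hB v
    simpa [hv] using this
  have hsub : s.1.A ∩ s.1.B ⊆ t.1.A ∩ t.1.B := fun v hv =>
    ⟨(hAZ v (Or.inl hv)).2 hv.1, (hBZ v (Or.inl hv)).2 hv.2⟩
  have hsk : (s.1.A ∩ s.1.B).ncard < k := (ncard_le_ncard hsub t.2).trans_lt htk
  have hrev := hX s.rev (rev_mem_endTangle fun hsτ => hs ⟨hsτ, hsk⟩)
    (by rw [Set.inter_comm]; exact hsk)
  have hlt := hX t ht htk
  have h1 : t.1.A ∩ ↑X = s.1.A ∩ ↑X := by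
    ext v
    exact and_congr_left fun hv => hAZ v (Or.inr hv)
  have h2 : t.1.B ∩ ↑X = s.1.B ∩ ↑X := by
    ext v
    exact and_congr_left fun hv => hBZ v (Or.inr hv)
  rw [h1, h2] at hlt
  exact lt_asymm hlt hrev

theorem degDomGE_of_isClosed {k : ℕ}
    (h : IsClosed {s : FinSep G | s ∈ endTangle ω ∧ (s.1.A ∩ s.1.B).ncard < k}) :
    DegDomGE G ω k := by
  classical
  by_contra hk
  have hno : ∀ D : Finset V, (∀ v ∈ D, Dominates G v ω) → D.card ≠ k := fun D hD hDk =>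
    hk ⟨0, k, by simp, ⟨Fin.elim0, fun i => i.elim0, fun i => i.elim0⟩, D, hDk, hD⟩
  have hfin : {v | Dominates G v ω}.Finite := by
    by_contra hinf
    obtain ⟨D, hD, hDk⟩ := Set.Infinite.exists_subset_card_eq hinf k
    exact hno D (fun v hv => hD hv) hDk
  obtain ⟨D, hD⟩ : ∃ D : Finset V, ∀ v, v ∈ D ↔ Dominates G v ω :=
    ⟨hfin.toFinset, fun v => by simp⟩
  have hDk : D.card ≤ k := by
    by_contra! hlt
    obtain ⟨D', hD', hD'k⟩ := Finset.exists_subset_card_eq hlt.le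
    exact hno D' (fun v hv => (hD v).1 (hD' hv)) hD'k
  let s : FinSep G := ⟨⟨univ, ↑D, by simp, fun a _ b hb => absurd (mem_univ b) hb.2⟩,
    by simp⟩
  have hs : s ∈ {s : FinSep G | s ∈ endTangle ω ∧ (s.1.A ∩ s.1.B).ncard < k}ᶜ := by
    rintro ⟨hs, -⟩
    obtain ⟨R, hR⟩ := ω.nonempty
    obtain ⟨N, hN⟩ := hs R hR
    obtain ⟨N', hN'⟩ := R.eventually_not_mem D.finite_toSet
    exact hN' _ (le_max_right N N') (hN _ (le_max_left N N'))
  obtain ⟨Z, hZ, hZs⟩ := exists_finite_of_isOpen h.isOpen_compl hs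
  obtain ⟨T, hT, hTk⟩ := exists_small_endSeparator hD hk hDk (Z := hZ.toFinset \ D)
    (fun z hz => (Finset.mem_sdiff.1 hz).2)
  have hTD : (↑T ∪ ↑D : Set V).Finite := T.finite_toSet.union D.finite_toSet
  have hZT : ∀ v ∈ Z, v ∉ endComp ω (↑T ∪ ↑D) := by
    intro v hv hvC
    by_cases hvD : v ∈ D
    · exact not_mem_of_mem_endComp hvC (Or.inr hvD)
    · exact hT.sep v (by simp [hv, hvD]) hvC
  refine hZs (endCompSep ω _ hTD) ?_ ?_ ⟨endCompSep_mem_endTangle hTD, ?_⟩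
  · ext v
    constructor
    · exact fun hv => ⟨mem_univ v, hv.2⟩
    · exact fun hv => ⟨hZT v hv.2, hv.2⟩
  · ext v
    constructor
    · rintro ⟨(hv | hv) | hv, hvZ⟩
      · by_contra hvD
        exact (hT.not_mem v hv).1 (by
          have : v ∉ D := fun h => hvD ⟨h, hvZ⟩
          simp [hvZ, this])
      · exact ⟨hv, hvZ⟩
      · exact absurd hv (hZT v hvZ)
    · exact fun hv => ⟨Or.inl (Or.inr hv.1), hv.2⟩
  · refine (ncard_endCompSep_le hTD).trans_lt (lt_of_le_of_lt (ncard_union_le _ _) ?_)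
    simpa using hTk

theorem exists_tangle_layers {ι : Type*} [Finite ι] {R : ι → GraphRay G}
    (hR : ∀ i, R i ∈ ω.rays) {D : Finset V} (hD : ∀ v ∈ D, Dominates G v ω) (N : ι → ℕ) :
    ∃ L : ℕ → Finset V, (∀ t, (∀ x ∈ L t, ∀ y ∈ L t, WalkIn G (L t) x y) ∧
      (∀ i, ∃ j ≥ N i, (R i).f j ∈ L t) ∧ ∀ d ∈ D, ∃ u ∈ L t, G.Adj d u) ∧
      ∀ t t', t < t' → Disjoint (L t) (L t') := by
  classical
  refine exists_seq_of_forall_finset_exists (fun L : Finset V =>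
    (∀ x ∈ L, ∀ y ∈ L, WalkIn G L x y) ∧
      (∀ i, ∃ j ≥ N i, (R i).f j ∈ L) ∧ ∀ d ∈ D, ∃ u ∈ L, G.Adj d u) Disjoint fun s _ => ?_
  let F : Set V := ↑(s.biUnion id)
  have hF : F.Finite := Finset.finite_toSet _
  have h1 : ∀ i, ∃ j ≥ N i, (R i).f j ∈ endComp ω F := by
    intro i
    obtain ⟨M, hM⟩ := eventually_mem_endComp hF (hR i)
    exact ⟨max (N i) M, le_max_left _ _, hM _ (le_max_right _ _)⟩
  have h2 : ∀ d ∈ D, ∃ u ∈ endComp ω F, G.Adj d u := fun d hd => (hD d hd).exists_adj hF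
  choose j hj hjC using h1
  choose! u huC hu using h2
  obtain ⟨L, hTL, hLC, hL⟩ := exists_finset_connected hF
    (T := range (fun i => (R i).f (j i)) ∪ u '' ↑D)
    ((finite_range _).union (D.finite_toSet.image u)) (by
      rintro x (⟨i, rfl⟩ | ⟨d, hd, rfl⟩)
      exacts [hjC i, huC d hd])
  refine ⟨L, ⟨hL, fun i => ⟨j i, hj i, hTL (Or.inl ⟨i, rfl⟩)⟩,
    fun d hd => ⟨u d, hTL (Or.inr ⟨d, hd, rfl⟩), hu d hd⟩⟩, fun L' hL' => ?_⟩
  rw [Finset.disjoint_left]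
  intro x hx hx'
  exact not_mem_of_mem_endComp (hLC hx') (Finset.mem_biUnion.2 ⟨L', hL', hx⟩)

theorem exists_disjoint_of_ncard_lt {L : ℕ → Finset V}
    (hL : ∀ t t', t < t' → Disjoint (L t) (L t')) {K : Set V} (hK : K.Finite) {k : ℕ}
    (hKk : K.ncard < k) : ∃ t < k, Disjoint (L t : Set V) K := by
  by_contra! h
  have h' : ∀ t : Fin k, ∃ y, y ∈ L t ∧ y ∈ K := fun t => Set.not_disjoint_iff.1 (h t t.2)
  choose y hyL hyK using h'
  have hinj : Function.Injective y := by
    intro t t' htt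
    rcases lt_trichotomy t t' with hlt | heq | hlt
    · exact absurd (htt ▸ hyL t') (Finset.disjoint_left.1 (hL _ _ hlt) (hyL t))
    · exact heq
    · exact absurd (htt ▸ hyL t) (Finset.disjoint_left.1 (hL _ _ hlt) (hyL t'))
  have : (range y).ncard ≤ K.ncard :=
    ncard_le_ncard (by rintro _ ⟨t, rfl⟩; exact hyK t) hK
  rw [← Set.image_univ, ncard_image_of_injective _ hinj, ncard_univ, Nat.card_fin] at this
  omega

theorem exists_decider_of_degDomGE {k : ℕ} (h : DegDomGE G ω k) :
    ∃ X : Finset V, X.card = k ∧ ∀ s ∈ endTangle ω, (s.1.A ∩ s.1.B).ncard < k →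
      (s.1.A ∩ ↑X).ncard < (s.1.B ∩ ↑X).ncard := by
  classical
  obtain ⟨m, n, hmn, ⟨R, hR, hRdisj⟩, D, hDn, hD⟩ := h
  have hRinj : ∀ {i j a b}, (R i).f a = (R j).f b → i = j ∧ a = b := by
    intro i j a b hab
    have hij : i = j := by
      by_contra hne
      exact Set.disjoint_left.1 (hRdisj i j hne) ⟨a, rfl⟩ ⟨b, hab.symm⟩
    subst hij
    exact ⟨rfl, (R i).inj hab⟩
  choose N hN using fun i => (R i).eventually_not_mem D.finite_toSet
  obtain ⟨L, hL, hLdisj⟩ := exists_tangle_layers hR hD N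
  choose hit hhitN hhitL using fun t => (hL t).2.1
  let idx : Fin m → ℕ := fun i => N i + ∑ t ∈ Finset.range k, hit t i + 1
  have hNidx : ∀ i, N i < idx i := fun i => by simp only [idx]; omega
  have hhit_lt : ∀ t < k, ∀ i, hit t i < idx i := by
    intro t ht i
    have := Finset.single_le_sum (f := fun t => hit t i) (fun _ _ => Nat.zero_le _)
      (Finset.mem_range.2 ht)
    simp only [idx] at this ⊢
    omega
  let x : Fin m → V := fun i => (R i).f (idx i)
  have hx : Function.Injective x := fun i j hij => (hRinj hij).1
  have hDx : Disjoint D (Finset.univ.image x) := by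
    rw [Finset.disjoint_right]
    intro y hy
    obtain ⟨i, -, rfl⟩ := Finset.mem_image.1 hy
    exact hN i _ (hNidx i).le
  have hXcard : (D ∪ Finset.univ.image x).card = k := by
    rw [Finset.card_union_of_disjoint hDx, Finset.card_image_of_injective _ hx, Finset.card_univ,
      Fintype.card_fin]
    omega
  refine ⟨D ∪ Finset.univ.image x, hXcard, fun s hs hsk => ?_⟩
  set X := D ∪ Finset.univ.image x with hX
  have hDB : ∀ d ∈ D, d ∈ s.1.B := fun d hd => (hD d hd).mem_B hs
  have hafter : ∀ i a, (R i).f a ∈ s.1.A \ s.1.B → ∃ b > a, (R i).f b ∈ s.1.A ∩ s.1.B := by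
    intro i a ha
    by_contra! hcon
    obtain ⟨M, hM⟩ := hs (R i) (hR i)
    have hwalk : WalkIn G (s.1.A ∩ s.1.B)ᶜ ((R i).f a) ((R i).f (max a M)) := by
      refine (R i).walkIn (le_max_left _ _) fun j hj _ => ?_
      rcases hj.eq_or_lt with rfl | hj
      · exact fun h => ha.2 h.2
      · exact hcon j hj
    exact (s.mem_A_diff_of_walkIn hwalk disjoint_compl_left ha).2 (hM _ (le_max_right _ _))
  have hbefore : ∀ i, x i ∈ s.1.A \ s.1.B →
      ∃ a, N i ≤ a ∧ a < idx i ∧ (R i).f a ∈ s.1.A ∩ s.1.B := by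
    intro i hi
    by_contra! hcon
    obtain ⟨t, htk, ht⟩ := exists_disjoint_of_ncard_lt hLdisj s.2 hsk
    have hwalk : WalkIn G (s.1.A ∩ s.1.B)ᶜ ((R i).f (hit t i)) (x i) := by
      refine (R i).walkIn (hhit_lt t htk i).le fun j hj hj' => ?_
      rcases hj'.eq_or_lt with rfl | hj'
      · exact fun h => hi.2 h.2
      · exact hcon j ((hhitN t i).trans hj) hj'
    have hmem := s.mem_A_diff_of_walkIn hwalk.symm disjoint_compl_left hi
    have hLA : ∀ y ∈ L t, y ∈ s.1.A \ s.1.B := fun y hy =>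
      s.mem_A_diff_of_walkIn ((hL t).1 _ (hhitL t i) y hy) ht hmem
    have hDA : ∀ d ∈ D, d ∈ s.1.A ∩ s.1.B := by
      intro d hd
      obtain ⟨u, hu, hdu⟩ := (hL t).2.2 d hd
      exact ⟨s.mem_A_of_adj hdu.symm (hLA u hu), hDB d hd⟩
    choose b hb hbK using fun j => hafter j _ (hLA _ (hhitL t j))
    have hsub : (↑(D ∪ Finset.univ.image fun j => (R j).f (b j)) : Set V) ⊆ s.1.A ∩ s.1.B := by
      intro y hy
      rcases Finset.mem_union.1 hy with hy | hy
      · exact hDA y hy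
      · obtain ⟨j, -, rfl⟩ := Finset.mem_image.1 hy
        exact hbK j
    have hcard := ncard_le_ncard hsub s.2
    rw [ncard_coe_finset, Finset.card_union_of_disjoint, Finset.card_image_of_injective,
      Finset.card_univ, Fintype.card_fin] at hcard
    · omega
    · exact fun i j hij => (hRinj hij).1
    · rw [Finset.disjoint_right]
      intro y hy
      obtain ⟨j, -, rfl⟩ := Finset.mem_image.1 hy
      exact hN j _ ((hhitN t j).trans (hb j).le)
  let I : Finset (Fin m) := Finset.univ.filter fun i => x i ∈ s.1.A \ s.1.B
  have hI : ∀ i, i ∈ I ↔ x i ∈ s.1.A \ s.1.B := fun i => by simp [I]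
  have hb : ∀ i ∈ I, ∃ b, idx i < b ∧ (R i).f b ∈ s.1.A ∩ s.1.B := fun i hi =>
    hafter i _ ((hI i).1 hi)
  have ha : ∀ i ∈ I, ∃ a, N i ≤ a ∧ a < idx i ∧ (R i).f a ∈ s.1.A ∩ s.1.B := fun i hi =>
    hbefore i ((hI i).1 hi)
  choose! a haN haidx haK using ha
  choose! b hbidx hbK using hb
  let K₀ : Finset V := X.filter (· ∈ s.1.A ∩ s.1.B)
  have himage : ∀ c : Fin m → ℕ, (I.image fun i => (R i).f (c i)).card = I.card := fun c =>
    Finset.card_image_of_injective _ fun i j hij => (hRinj hij).1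
  have hnotX : ∀ i c, N i ≤ c → c ≠ idx i → (R i).f c ∉ X := by
    intro i c hc hne hcX
    rcases Finset.mem_union.1 hcX with h | h
    · exact hN i c hc h
    · obtain ⟨j, -, hj⟩ := Finset.mem_image.1 h
      obtain ⟨rfl, h'⟩ := hRinj hj
      exact hne h'.symm
  have hK : K₀.card + I.card + I.card < k := by
    have hsub : (↑((K₀ ∪ I.image fun i => (R i).f (a i)) ∪ I.image fun i => (R i).f (b i)) :
        Set V) ⊆ s.1.A ∩ s.1.B := by
      intro y hy
      rcases Finset.mem_union.1 hy with hy | hy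
      · rcases Finset.mem_union.1 hy with hy | hy
        · exact (Finset.mem_filter.1 hy).2
        · obtain ⟨i, hi, rfl⟩ := Finset.mem_image.1 hy
          exact haK i hi
      · obtain ⟨i, hi, rfl⟩ := Finset.mem_image.1 hy
        exact hbK i hi
    have hcard := ncard_le_ncard hsub s.2
    rw [ncard_coe_finset, Finset.card_union_of_disjoint, Finset.card_union_of_disjoint,
      himage, himage] at hcard
    · omega
    · rw [Finset.disjoint_right]
      intro y hy hy'
      obtain ⟨i, hi, rfl⟩ := Finset.mem_image.1 hy
      exact hnotX i _ (haN i hi) (haidx i hi).ne (Finset.mem_filter.1 hy').1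
    · rw [Finset.disjoint_right]
      intro y hy hy'
      obtain ⟨i, hi, rfl⟩ := Finset.mem_image.1 hy
      rcases Finset.mem_union.1 hy' with hy' | hy'
      · exact hnotX i _ ((hNidx i).trans (hbidx i hi)).le (hbidx i hi).ne'
          (Finset.mem_filter.1 hy').1
      · obtain ⟨j, hj, hji⟩ := Finset.mem_image.1 hy'
        obtain ⟨rfl, hab⟩ := hRinj hji
        have := haidx j hj
        have := hbidx j hj
        omega
  have hxI : (I.image x).card = I.card := Finset.card_image_of_injective _ hx
  have hside : ∀ y ∈ X, y ∉ s.1.B → y ∈ I.image x := by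
    intro y hy hyB
    rcases Finset.mem_union.1 hy with hy | hy
    · exact absurd (hDB y hy) hyB
    · obtain ⟨i, -, rfl⟩ := Finset.mem_image.1 hy
      exact Finset.mem_image_of_mem x ((hI i).2 ⟨(s.mem_or _).resolve_right hyB, hyB⟩)
  have hAX : (s.1.A ∩ ↑X).ncard ≤ I.card + K₀.card := by
    have hsub : s.1.A ∩ ↑X ⊆ ↑(I.image x ∪ K₀) := by
      rintro y ⟨hyA, hyX⟩
      by_cases hyB : y ∈ s.1.B
      · exact Finset.mem_union_right _ (Finset.mem_filter.2 ⟨hyX, hyA, hyB⟩)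
      · exact Finset.mem_union_left _ (hside y hyX hyB)
    have := ncard_le_ncard hsub (Finset.finite_toSet _)
    rw [ncard_coe_finset] at this
    exact this.trans ((Finset.card_union_le _ _).trans (by rw [hxI]))
  have hBX : k ≤ (s.1.B ∩ ↑X).ncard + I.card := by
    have hsub : (↑X : Set V) ⊆ (s.1.B ∩ ↑X) ∪ ↑(I.image x) := by
      intro y hy
      by_cases hyB : y ∈ s.1.B
      · exact Or.inl ⟨hyB, hy⟩
      · exact Or.inr (hside y hy hyB)
    have := ncard_le_ncard hsub
      ((X.finite_toSet.inter_of_right _).union (Finset.finite_toSet _))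
    rw [ncard_coe_finset, hXcard] at this
    refine this.trans ((ncard_union_le _ _).trans ?_)
    rw [ncard_coe_finset, hxI]
  omega

end Tangle
/-- for an end tangle `τ = τ_ω` and `k ∈ ℕ` the following are
equivalent: `τ ∩ S⃗_k` is closed; `deg(ω) + dom(ω) ≥ k`; `τ ∩ S⃗_k` has a
finite relative decider; `τ ∩ S⃗_k` has a relative decider of size exactly `k`. -/
theorem closed_iff_deg_dom_iff_decider {V : Type u} (G : SimpleGraph V)
    (ω : GraphEnd G) (k : ℕ) :
    (IsClosed {s : FinSep G | s ∈ endTangle ω ∧ (s.1.A ∩ s.1.B).ncard < k} ↔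
      DegDomGE G ω k) ∧
    (DegDomGE G ω k ↔
      ∃ X : Finset V, ∀ s ∈ endTangle ω, (s.1.A ∩ s.1.B).ncard < k →
        (s.1.A ∩ ↑X).ncard < (s.1.B ∩ ↑X).ncard) ∧
    ((∃ X : Finset V, ∀ s ∈ endTangle ω, (s.1.A ∩ s.1.B).ncard < k →
        (s.1.A ∩ ↑X).ncard < (s.1.B ∩ ↑X).ncard) ↔
      ∃ X : Finset V, X.card = k ∧ ∀ s ∈ endTangle ω, (s.1.A ∩ s.1.B).ncard < k →
        (s.1.A ∩ ↑X).ncard < (s.1.B ∩ ↑X).ncard) := by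
  refine ⟨⟨degDomGE_of_isClosed, fun h => ?_⟩,
    ⟨fun h => ?_, fun ⟨X, hX⟩ => degDomGE_of_isClosed (isClosed_of_decider hX)⟩,
    ⟨fun ⟨X, hX⟩ => exists_decider_of_degDomGE (degDomGE_of_isClosed (isClosed_of_decider hX)),
      fun ⟨X, _, hX⟩ => ⟨X, hX⟩⟩⟩
  · obtain ⟨X, -, hX⟩ := exists_decider_of_degDomGE h
    exact isClosed_of_decider hX
  · obtain ⟨X, -, hX⟩ := exists_decider_of_degDomGE h
    exact ⟨X, hX⟩
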